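/- There exists a family {Q^n = ({S/n}, Σ^n, q(x̄))}_{n>0} of OMQs from (S, CQ) over the data schema consisting of a single n-ary predicate S, with ||Σ^n|| = O(n^2) symbols, such that for every OMQ Q = ({S}, Σ', q'(x̄)) ∈ (TGD, CQ) and every {S}-database D: if Q^n(D) ⊄ Q(D) then |D| ≥ 2^{n-2}. In particular, for every {S}-database D, Q^n(D) ≠ ∅ implies that D contains all facts S(c_1,…,c_{n-2}, 0, 1) with (c_1,…,c_{n-2}) ∈ {0,1}^{n-2}. -/

import Mathlib

/-! Core formalization: relational instances, conjunctive queries,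
tuple-generating dependencies (tgds) and ontology-mediated queries (OMQs). -/

/-- A schema: a list of (predicate name, arity) pairs. -/
abbrev RSig : Type := List (ℕ × ℕ)

/-- Terms populating instances: constants (`Sum.inl`) or labeled nulls (`Sum.inr`). -/
abbrev GTerm : Type := ℕ ⊕ ℕ

/-- Terms of queries and tgds: constants (`Sum.inl`) or variables (`Sum.inr`). -/
abbrev QTerm : Type := ℕ ⊕ ℕ

/-- A relational atom over terms of type `T`: a predicate name and a tuple of terms. -/
abbrev RAtom (T : Type) : Type := ℕ × List T

/-- A fact: an atom whose arguments are constants. -/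
abbrev DBFact : Type := RAtom ℕ

/-- A database: a finite list of facts. -/
abbrev Database : Type := List DBFact

/-- An instance with domain `α`. -/
abbrev GInst (α : Type) : Type := Set (RAtom α)

/-- An instance over constants and labeled nulls. -/
abbrev Inst : Type := GInst GTerm

def factAtom (f : DBFact) : RAtom GTerm := (f.1, f.2.map Sum.inl)

/-- The instance corresponding to a database. -/
def dbInst (D : Database) : Inst := {a | ∃ f ∈ D, factAtom f = a}

def atomOverSig {T : Type} (S : RSig) (a : RAtom T) : Prop := (a.1, a.2.length) ∈ S

/-- `D` is a database over the schema `S`. -/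
def DBover (S : RSig) (D : Database) : Prop := ∀ f ∈ D, atomOverSig S f

/-- `I` is an instance over the schema `S`. -/
def InstOver (S : RSig) (I : Inst) : Prop := ∀ a ∈ I, atomOverSig S a

/-- Active domain of a database. -/
def adomD (D : Database) : Set ℕ := {c | ∃ f ∈ D, c ∈ f.2}

/-- Active domain of an instance. -/
def instAdom {α : Type} (I : GInst α) : Set α := {s | ∃ a ∈ I, s ∈ a.2}

/-- `c` is a tuple from `adom(D)^n`. -/
def TupleIn (D : Database) (n : ℕ) (c : List ℕ) : Prop :=
  c.length = n ∧ ∀ x ∈ c, x ∈ adomD D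

/-- Variable assignments into the domain of instances. -/
abbrev Assign : Type := ℕ → GTerm

def applyT (ν : Assign) : QTerm → GTerm := Sum.elim Sum.inl ν

def applyA (ν : Assign) (a : RAtom QTerm) : RAtom GTerm := (a.1, a.2.map (applyT ν))

/-- A tgd, given as a pair (body, head) of lists of atoms. -/
abbrev TGD : Type := List (RAtom QTerm) × List (RAtom QTerm)

/-- Variables occurring in a list of atoms. -/
def varsOf (as : List (RAtom QTerm)) : Set ℕ := {v | ∃ a ∈ as, (Sum.inr v : QTerm) ∈ a.2}

/-- Satisfaction of a tgd by an instance: every homomorphic image of the body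
extends to a homomorphic image of the head (variables not occurring in the body
are existentially quantified). -/
def satTGD (I : Inst) (τ : TGD) : Prop :=
  ∀ ν : Assign, (∀ a ∈ τ.1, applyA ν a ∈ I) →
    ∃ ν' : Assign, (∀ v ∈ varsOf τ.1, ν' v = ν v) ∧ ∀ a ∈ τ.2, applyA ν' a ∈ I

def satAll (I : Inst) (Sg : List TGD) : Prop := ∀ τ ∈ Sg, satTGD I τ

/-- A fact tgd: a tgd with empty body. -/
def IsFactTGD (τ : TGD) : Prop := τ.1 = []

/-- A class of (finite sets of) tgds closed under fact tgd extension. -/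
def FactClosed (C : Set (List TGD)) : Prop :=
  ∀ Sg ∈ C, ∀ F : List TGD, (∀ τ ∈ F, IsFactTGD τ) → (Sg ++ F) ∈ C

/-- A conjunctive query: (list of free variables, body atoms). -/
abbrev CQ : Type := List ℕ × List (RAtom QTerm)

/-- A union of conjunctive queries. -/
abbrev UCQ : Type := List CQ

/-- Evaluation of a CQ over an instance: the set of answer tuples of constants. -/
def evalCQ (q : CQ) (I : Inst) : Set (List ℕ) :=
  {c | ∃ ν : Assign, (∀ a ∈ q.2, applyA ν a ∈ I) ∧ q.1.map ν = c.map Sum.inl}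

def evalUCQ (u : UCQ) (I : Inst) : Set (List ℕ) := {c | ∃ q ∈ u, c ∈ evalCQ q I}

/-- The predicates (with their arities) occurring in a finite set of tgds. -/
def schList (Sg : List TGD) : RSig :=
  Sg.flatMap (fun τ => (τ.1 ++ τ.2).map (fun a => (a.1, a.2.length)))

/-- Certain answers of a CQ w.r.t. an instance and a set of tgds. -/
def certAnsI (Sg : List TGD) (q : CQ) (I : Inst) : Set (List ℕ) :=
  {c | ∀ J : Inst, I ⊆ J → satAll J Sg → c ∈ evalCQ q J}

/-- Certain answers of a CQ w.r.t. a database and a set of tgds. -/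
def certAns (Sg : List TGD) (q : CQ) (D : Database) : Set (List ℕ) :=
  certAnsI Sg q (dbInst D)

/-- Certain answers of a UCQ w.r.t. a database and a set of tgds. -/
def certAnsU (Sg : List TGD) (u : UCQ) (D : Database) : Set (List ℕ) :=
  {c | ∀ J : Inst, dbInst D ⊆ J → satAll J Sg → c ∈ evalUCQ u J}

/-- An ontology-mediated query: (data schema, set of tgds, CQ). -/
abbrev OMQ : Type := RSig × List TGD × CQ

/-- Evaluation of an OMQ over a database: the certain answers. -/
def omqEval (Q : OMQ) (D : Database) : Set (List ℕ) := certAns Q.2.1 Q.2.2 D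

/-- Containment of two OMQs over the common data schema of `Q1`. -/
def omqContained (Q1 Q2 : OMQ) : Prop :=
  ∀ D : Database, DBover Q1.1 D → omqEval Q1 D ⊆ omqEval Q2 D

/-- A tgd is guarded if some body atom contains all body variables. -/
def GuardedTGD (τ : TGD) : Prop :=
  ∃ g ∈ τ.1, ∀ v ∈ varsOf τ.1, (Sum.inr v : QTerm) ∈ g.2

/-- A tgd is linear if its body consists of a single atom. -/
def LinearTGD (τ : TGD) : Prop := τ.1.length = 1

/-- Edge of the predicate graph of a set of tgds. -/
def predEdge (Sg : List TGD) (R P : ℕ) : Prop :=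
  ∃ τ ∈ Sg, (∃ a ∈ τ.1, a.1 = R) ∧ (∃ b ∈ τ.2, b.1 = P)

/-- A finite set of tgds is non-recursive if its predicate graph is acyclic. -/
def NonRecursive (Sg : List TGD) : Prop :=
  ∀ R : ℕ, ¬ Relation.TransGen (predEdge Sg) R R

/-- The inductive variable-marking procedure of Calì, Gottlob and Pieris:
`Marked Sg σ x` says that the body variable `x` of `σ` is marked in `Sg`. -/
inductive Marked (Sg : List TGD) : TGD → ℕ → Prop where
  | base (σ : TGD) (x : ℕ) (hσ : σ ∈ Sg) (hx : x ∈ varsOf σ.1)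
      (α : RAtom QTerm) (hα : α ∈ σ.2) (hnx : (Sum.inr x : QTerm) ∉ α.2) :
      Marked Sg σ x
  | prop (σ : TGD) (x : ℕ) (hσ : σ ∈ Sg) (hx : x ∈ varsOf σ.1)
      (α : RAtom QTerm) (hα : α ∈ σ.2) (hxα : (Sum.inr x : QTerm) ∈ α.2)
      (σ' : TGD) (hσ' : σ' ∈ Sg) (β : RAtom QTerm) (hβ : β ∈ σ'.1)
      (hpred : β.1 = α.1) (hlen : β.2.length = α.2.length)
      (hmk : ∀ i y : ℕ, α.2[i]? = some (Sum.inr x) →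
        β.2[i]? = some (Sum.inr y) → Marked Sg σ' y) :
      Marked Sg σ x

/-- A finite set of tgds is sticky if no tgd contains two occurrences
(in its body) of a marked variable. -/
def Sticky (Sg : List TGD) : Prop :=
  ∀ σ ∈ Sg, ∀ x : ℕ, Marked Sg σ x →
    (σ.1.map (fun a => a.2.count (Sum.inr x : QTerm))).sum ≤ 1

/-- Size (number of symbols) of an atom. -/
def atomSize {T : Type} (a : RAtom T) : ℕ := 1 + a.2.length

def tgdSize (τ : TGD) : ℕ := 1 + ((τ.1 ++ τ.2).map atomSize).sum

def cqSize (q : CQ) : ℕ := 1 + q.1.length + (q.2.map atomSize).sum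

/-- Number of symbols occurring in a finite set of tgds. -/
def sgSize (Sg : List TGD) : ℕ := (Sg.map tgdSize).sum

def omqSize (Q : OMQ) : ℕ := Q.1.length + sgSize Q.2.1 + cqSize Q.2.2

/-- The tuple `(f 0, …, f (m - 1), z, o)`. -/
def bitTuple {T : Type} (m : ℕ) (f : ℕ → T) (z o : T) : List T :=
  (List.range m).map f ++ [z, o]

/-- The atom with predicate `p` whose `j`-th argument is the variable `f j` for `j < m`, followed
by the variables `m` and `m + 1`, which stand for the bits zero and one. -/
def varAtom (m p : ℕ) (f : ℕ → ℕ) : RAtom QTerm :=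
  (p, bitTuple m (fun j => Sum.inr (f j)) (Sum.inr m) (Sum.inr (m + 1)))

/-- `S(x̄, z, o) → P_m(x̄, z, o)`, where `S` is predicate `0` and `P_i` is predicate `i + 2`. -/
def initRule (m : ℕ) : TGD := ([varAtom m 0 id], [varAtom m (m + 2) id])

/-- `P_{i+1}(x̄[i ↦ z], z, o), P_{i+1}(x̄[i ↦ o], z, o) → P_i(x̄[i ↦ z], z, o)`. -/
def mergeRule (m i : ℕ) : TGD :=
  ([varAtom m (i + 3) (Function.update id i m), varAtom m (i + 3) (Function.update id i (m + 1))],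
    [varAtom m (i + 2) (Function.update id i m)])

/-- `P_0(z, …, z, z, o) → Ans(z, o)`, where `Ans` is predicate `1`. -/
def answerRule (m : ℕ) : TGD :=
  ([varAtom m 2 (fun _ => m)], [(1, [Sum.inr m, Sum.inr (m + 1)])])

/-- The sticky set of tgds collecting all bit vectors of length `m`. -/
def bitRules (m : ℕ) : List TGD :=
  initRule m :: answerRule m :: (List.range m).map (mergeRule m)

/-- The Boolean query `Ans(0, 1)`. -/
def answerQuery : CQ := ([], [(1, [Sum.inl 0, Sum.inl 1])])

theorem mem_bitRules {m : ℕ} {τ : TGD} :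
    τ ∈ bitRules m ↔ τ = initRule m ∨ τ = answerRule m ∨ ∃ i < m, mergeRule m i = τ := by
  simp [bitRules]

@[simp]
theorem length_bitTuple {T : Type} (m : ℕ) (f : ℕ → T) (z o : T) :
    (bitTuple m f z o).length = m + 2 := by
  simp [bitTuple]

theorem map_bitTuple {T U : Type} (g : T → U) (m : ℕ) (f : ℕ → T) (z o : T) :
    (bitTuple m f z o).map g = bitTuple m (fun j => g (f j)) (g z) (g o) := by
  simp [bitTuple]

theorem bitTuple_inj {T : Type} {m : ℕ} {f f' : ℕ → T} {z z' o o' : T} :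
    bitTuple m f z o = bitTuple m f' z' o' ↔ (∀ j < m, f j = f' j) ∧ z = z' ∧ o = o' := by
  constructor
  · intro h
    obtain ⟨hf, hzo⟩ := List.append_inj h (by simp)
    simp_all
  · rintro ⟨hf, rfl, rfl⟩
    unfold bitTuple
    congr 1
    exact List.map_congr_left fun j hj => hf j (List.mem_range.1 hj)

theorem applyA_varAtom (ν : Assign) (m p : ℕ) (f : ℕ → ℕ) :
    applyA ν (varAtom m p f) = (p, bitTuple m (fun j => ν (f j)) (ν m) (ν (m + 1))) := by
  simp [applyA, varAtom, map_bitTuple, applyT]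

theorem inr_mem_varAtom {m p x : ℕ} {f : ℕ → ℕ} :
    (Sum.inr x : QTerm) ∈ (varAtom m p f).2 ↔ (∃ j < m, f j = x) ∨ x = m ∨ x = m + 1 := by
  simp [varAtom, bitTuple]

theorem exists_inr_of_mem_varAtom {m p : ℕ} {f : ℕ → ℕ} {t : QTerm}
    (ht : t ∈ (varAtom m p f).2) : ∃ y, t = Sum.inr y := by
  simp only [varAtom, bitTuple, List.mem_append, List.mem_map, List.mem_cons] at ht
  aesop

/-- Tgds without constants in the body that propagate every body variable to every head atom do
not mark any variable. -/
theorem sticky_of_propagating {Sg : List TGD}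
    (hvar : ∀ σ ∈ Sg, ∀ x ∈ varsOf σ.1, ∀ α ∈ σ.2, (Sum.inr x : QTerm) ∈ α.2)
    (hbody : ∀ σ ∈ Sg, ∀ β ∈ σ.1, ∀ t ∈ β.2, ∃ y, t = Sum.inr y) : Sticky Sg := by
  intro σ _ x hmarked
  exfalso
  induction hmarked with
  | base σ x hσ hx α hα hnx => exact hnx (hvar σ hσ x hx α hα)
  | prop σ x hσ hx α hα hxα σ' hσ' β hβ hpred hlen hmk ih =>
    obtain ⟨i, hi, hix⟩ := List.getElem_of_mem hxα
    obtain ⟨y, hy⟩ := hbody σ' hσ' β hβ _ (List.getElem_mem (hlen ▸ hi))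
    exact ih i y (by simp [hi, hix]) (by rw [List.getElem?_eq_getElem (hlen ▸ hi), hy]) hσ'

theorem sticky_bitRules (m : ℕ) : Sticky (bitRules m) := by
  apply sticky_of_propagating
  · intro σ hσ x hx α hα
    obtain ⟨β, hβ, hxβ⟩ := hx
    rcases mem_bitRules.1 hσ with rfl | rfl | ⟨i, hi, rfl⟩
    · simp only [initRule, List.mem_singleton] at hα hβ
      subst hα hβ
      rw [inr_mem_varAtom] at hxβ ⊢
      exact hxβ
    · simp only [answerRule, List.mem_singleton] at hα hβ
      subst hα hβ
      rw [inr_mem_varAtom] at hxβ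
      simp only [List.mem_cons, Sum.inr.injEq, List.not_mem_nil, or_false]
      grind
    · simp only [mergeRule, List.mem_cons, List.not_mem_nil, or_false] at hα hβ
      subst hα
      rw [inr_mem_varAtom]
      rcases hβ with rfl | rfl
      · exact inr_mem_varAtom.1 hxβ
      · rcases inr_mem_varAtom.1 hxβ with ⟨j, hj, h⟩ | h
        · by_cases hji : j = i
          · subst hji
            simp at h
            omega
          · exact Or.inl ⟨j, hj, by simpa [hji] using h⟩
        · exact Or.inr h
  · intro σ hσ β hβ t ht
    rcases mem_bitRules.1 hσ with rfl | rfl | ⟨i, hi, rfl⟩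
    · simp only [initRule, List.mem_singleton] at hβ
      subst hβ
      exact exists_inr_of_mem_varAtom ht
    · simp only [answerRule, List.mem_singleton] at hβ
      subst hβ
      exact exists_inr_of_mem_varAtom ht
    · simp only [mergeRule, List.mem_cons, List.not_mem_nil, or_false] at hβ
      rcases hβ with rfl | rfl <;> exact exists_inr_of_mem_varAtom ht

theorem sgSize_bitRules (m : ℕ) : sgSize (bitRules m) = 3 * m ^ 2 + 13 * m + 14 := by
  have hmerge : tgdSize ∘ mergeRule m = fun _ => 3 * m + 10 := by
    funext i
    simp [tgdSize, mergeRule, atomSize, varAtom]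
    ring
  simp only [sgSize, bitRules, List.map_cons, List.map_map, hmerge, List.sum_cons]
  simp [tgdSize, initRule, answerRule, atomSize, varAtom]
  ring

/-- The model of `bitRules m` over `D` in which `P_i(x̄, z, o)` holds when `D` contains
`S(ȳ, z, o)` for every `ȳ` that agrees with `x̄` below `i` and has its other entries in
`{z, o}`. -/
def bitModel (m : ℕ) (D : Database) : Inst :=
  dbInst D ∪
    {a | ∃ z o, a = (1, [z, o]) ∧
      ∀ g : ℕ → GTerm, (∀ j < m, g j = z ∨ g j = o) → (0, bitTuple m g z o) ∈ dbInst D} ∪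
    {a | ∃ i f z o, a = (i + 2, bitTuple m f z o) ∧
      ∀ g : ℕ → GTerm, (∀ j < i, j < m → g j = f j) →
        (∀ j < m, i ≤ j → g j = z ∨ g j = o) → (0, bitTuple m g z o) ∈ dbInst D}

section

variable {m : ℕ} {D : Database}

theorem pred_eq_zero_of_mem_dbInst {n : ℕ} (hD : DBover [(0, n)] D) {a : RAtom GTerm}
    (ha : a ∈ dbInst D) : a.1 = 0 := by
  obtain ⟨f, hf, rfl⟩ := ha
  have := hD f hf
  simp only [atomOverSig, List.mem_singleton, Prod.mk.injEq] at this
  exact this.1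

theorem zero_mem_bitModel {t : List GTerm} :
    ((0, t) : RAtom GTerm) ∈ bitModel m D ↔ (0, t) ∈ dbInst D := by
  simp [bitModel]

theorem one_mem_bitModel {n : ℕ} (hD : DBover [(0, n)] D) {z o : GTerm} :
    ((1, [z, o]) : RAtom GTerm) ∈ bitModel m D ↔
      ∀ g : ℕ → GTerm, (∀ j < m, g j = z ∨ g j = o) → (0, bitTuple m g z o) ∈ dbInst D := by
  constructor
  · rintro ((h | ⟨z', o', h, hg⟩) | ⟨i, f, z', o', h, -⟩)
    · exact absurd (pred_eq_zero_of_mem_dbInst hD h) (by simp)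
    · simp only [Prod.mk.injEq, List.cons.injEq, and_true, true_and] at h
      obtain ⟨rfl, rfl⟩ := h
      exact hg
    · have := congrArg Prod.fst h
      simp only at this
      omega
  · exact fun h => Or.inl (Or.inr ⟨z, o, rfl, h⟩)

theorem add_two_mem_bitModel {n : ℕ} (hD : DBover [(0, n)] D) {i : ℕ} {f : ℕ → GTerm}
    {z o : GTerm} :
    ((i + 2, bitTuple m f z o) : RAtom GTerm) ∈ bitModel m D ↔
      ∀ g : ℕ → GTerm, (∀ j < i, j < m → g j = f j) →
        (∀ j < m, i ≤ j → g j = z ∨ g j = o) → (0, bitTuple m g z o) ∈ dbInst D := by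
  constructor
  · rintro ((h | ⟨z', o', h, -⟩) | ⟨i', f', z', o', h, hg⟩)
    · exact absurd (pred_eq_zero_of_mem_dbInst hD h) (by simp)
    · have := congrArg Prod.fst h
      simp only at this
      omega
    · simp only [Prod.mk.injEq, Nat.add_right_cancel_iff, bitTuple_inj] at h
      obtain ⟨rfl, hf, rfl, rfl⟩ := h
      exact fun g hlow => hg g fun j hj hjm => (hlow j hj hjm).trans (hf j hjm)
  · exact fun h => Or.inr ⟨i, f, z, o, rfl, h⟩

theorem satAll_bitModel {n : ℕ} (hD : DBover [(0, n)] D) :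
    satAll (bitModel m D) (bitRules m) := by
  intro τ hτ ν hν
  refine ⟨ν, fun _ _ => rfl, ?_⟩
  rcases mem_bitRules.1 hτ with rfl | rfl | ⟨i, hi, rfl⟩
  · simp only [initRule, List.forall_mem_singleton, applyA_varAtom] at hν ⊢
    rw [zero_mem_bitModel] at hν
    rw [add_two_mem_bitModel hD]
    intro g hg _
    rwa [bitTuple_inj.2 ⟨fun j hj => hg j hj hj, rfl, rfl⟩]
  · simp only [answerRule, List.forall_mem_singleton, applyA_varAtom] at hν ⊢
    rw [show (2 : ℕ) = 0 + 2 from rfl, add_two_mem_bitModel hD] at hν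
    change ((1, [ν m, ν (m + 1)]) : RAtom GTerm) ∈ bitModel m D
    rw [one_mem_bitModel hD]
    exact fun g hg => hν g (by simp) fun j hj _ => hg j hj
  · have hmerge_zero := hν _ (List.mem_cons_self ..)
    have hmerge_one := hν _ (List.mem_cons_of_mem _ (List.mem_cons_self ..))
    simp only [mergeRule, List.forall_mem_singleton]
    rw [applyA_varAtom] at hmerge_zero hmerge_one ⊢
    rw [show i + 3 = (i + 1) + 2 from rfl, add_two_mem_bitModel hD] at hmerge_zero hmerge_one
    rw [add_two_mem_bitModel hD]
    intro g hlow hhigh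
    rcases hhigh i hi le_rfl with hgi | hgi
    · refine hmerge_zero g (fun j hj hjm => ?_) fun j hj hij => hhigh j hj (by omega)
      rcases eq_or_ne j i with rfl | hji
      · simpa using hgi
      · exact hlow j (by omega) hjm
    · refine hmerge_one g (fun j hj hjm => ?_) fun j hj hij => hhigh j hj (by omega)
      rcases eq_or_ne j i with rfl | hji
      · simpa using hgi
      · simpa [hji] using hlow j (by omega) hjm

theorem factAtom_injective : Function.Injective factAtom := by
  rintro ⟨p, s⟩ ⟨p', s'⟩ h
  simp only [factAtom, Prod.mk.injEq] at h
  exact Prod.ext h.1 (List.map_injective_iff.2 Sum.inl_injective h.2)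

theorem mem_of_omqEval_nonempty {n : ℕ} (hD : DBover [(0, n)] D)
    (h : (omqEval ([(0, n)], bitRules m, answerQuery) D).Nonempty)
    {cs : List ℕ} (hlen : cs.length = m) (hcs : ∀ x ∈ cs, x = 0 ∨ x = 1) :
    ((0, cs ++ [0, 1]) : DBFact) ∈ D := by
  obtain ⟨c, hc⟩ := h
  obtain ⟨ν, hν, -⟩ := hc (bitModel m D) (fun a ha => Or.inl (Or.inl ha)) (satAll_bitModel hD)
  simp only [answerQuery, List.forall_mem_singleton] at hν
  change ((1, [Sum.inl 0, Sum.inl 1]) : RAtom GTerm) ∈ bitModel m D at hν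
  rw [one_mem_bitModel hD] at hν
  obtain ⟨f, hf, hfa⟩ := hν (fun j => Sum.inl (cs.getD j 0)) fun j hj => by
    have hj' : j < cs.length := hlen ▸ hj
    simpa [hj'] using hcs _ (List.getElem_mem hj')
  have htuple : bitTuple m (fun j => (Sum.inl (cs.getD j 0) : GTerm)) (Sum.inl 0) (Sum.inl 1) =
      (cs ++ [0, 1]).map Sum.inl := by
    rw [← map_bitTuple]
    congr 1
    unfold bitTuple
    congr 1
    apply List.ext_getElem <;> simp_all
  rw [htuple] at hfa
  rwa [← factAtom_injective (a₁ := f) (a₂ := (0, cs ++ [0, 1])) hfa]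

theorem two_pow_le_card_of_forall_mem
    (h : ∀ cs : List ℕ, cs.length = m → (∀ x ∈ cs, x = 0 ∨ x = 1) →
      ((0, cs ++ [0, 1]) : DBFact) ∈ D) : 2 ^ m ≤ D.toFinset.card := by
  let e : (Fin m → Fin 2) → DBFact := fun b => (0, List.ofFn (fun i => (b i : ℕ)) ++ [0, 1])
  have he : Function.Injective e := by
    intro b b' hb
    simp only [e, Prod.mk.injEq, true_and, List.append_cancel_right_eq] at hb
    funext i
    exact Fin.ext (congrFun (List.ofFn_injective hb) i)
  calc 2 ^ m = (Finset.univ.image e).card := by simp [Finset.card_image_of_injective _ he]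
    _ ≤ D.toFinset.card := Finset.card_le_card fun a ha => by
      obtain ⟨b, -, rfl⟩ := Finset.mem_image.1 ha
      refine List.mem_toFinset.2 (h _ (by simp) fun x hx => ?_)
      obtain ⟨i, rfl⟩ := List.mem_ofFn.1 hx
      omega

end

/-- exponential witnesses for sticky OMQs are needed.
There is a family `{Q^n = ({S/n}, Σ^n, q(x̄))}` of OMQs from `(S, CQ)` over the
data schema consisting of a single `n`-ary predicate, with `||Σ^n|| = O(n²)`,
such that for every OMQ `Q = ({S}, Σ', q'(x̄)) ∈ (TGD, CQ)` and every
`{S}`-database `D`: if `Q^n(D) ⊄ Q(D)` then `|D| ≥ 2^{n-2}`; moreover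
`Q^n(D) ≠ ∅` implies that `D` contains all facts `S(c_1,…,c_{n-2},0,1)` with
`(c_1,…,c_{n-2}) ∈ {0,1}^{n-2}`. -/
theorem statement_11 :
    ∃ (sname : ℕ) (Sg : ℕ → List TGD) (q : CQ) (c : ℕ),
      ∀ n : ℕ, 0 < n →
        Sticky (Sg n) ∧ sgSize (Sg n) ≤ c * n ^ 2 ∧
        (∀ (Sg' : List TGD) (q' : CQ), ∀ D : Database,
          DBover [(sname, n)] D →
          ¬ (omqEval ([(sname, n)], Sg n, q) D ⊆ omqEval ([(sname, n)], Sg', q') D) →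
          2 ^ (n - 2) ≤ D.toFinset.card) ∧
        (∀ D : Database, DBover [(sname, n)] D →
          (omqEval ([(sname, n)], Sg n, q) D).Nonempty →
          ∀ cs : List ℕ, cs.length = n - 2 → (∀ x ∈ cs, x = 0 ∨ x = 1) →
            ((sname, cs ++ [0, 1]) : DBFact) ∈ D) := by
  refine ⟨0, fun n => bitRules (n - 2), answerQuery, 14, fun n hn => ⟨sticky_bitRules _, ?_, ?_, ?_⟩⟩
  · rw [sgSize_bitRules]
    rcases Nat.lt_or_ge n 2 with h | h
    · obtain rfl : n = 1 := by omega
      simp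
    · obtain ⟨m, rfl⟩ := Nat.exists_eq_add_of_le' h
      simp only [Nat.add_sub_cancel]
      nlinarith
  · intro Sg' q' D hD hsub
    obtain ⟨c, hc, -⟩ := Set.not_subset.1 hsub
    exact two_pow_le_card_of_forall_mem fun cs => mem_of_omqEval_nonempty hD ⟨c, hc⟩
  · exact fun D hD hne cs => mem_of_omqEval_nonempty hD hne
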